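/- Let d ≥ 1 and 1 ≤ M ≤ N, with P₊^{(k)}, d₊^{(k)} = C(d+k−1,k), K and C⁺ := (P₊^{(M)} ⊗ P₊^{(N)}) · K · (P₊^{(M)} ⊗ P₊^{(N)}) as in the Choi matrix of the symmetric partial trace channel from N to M copies of a d-dimensional system. For a real number p ≥ 0, there exists a positive semidefinite matrix ρ₀ on (Fin M → Fin d) with trace 1 and P₊^{(M)} · ρ₀ · P₊^{(M)} = ρ₀ such that (ρ₀ ⊗ P₊^{(N)}) − p·C⁺ is positive semidefinite, if and only if p ≤ d₊^{(N−M)}/(d₊^{(N)}·d₊^{(M)}). (The maximum probability of teleporting M copies of an unknown pure state to the past given N ≥ M copies in the future is d₊^{(N−M)}/(d₊^{(N)}d₊^{(M)}); in particular, for M = 1 it equals N/(d(d+N−1)).) -/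

import Mathlib

open Matrix
open scoped Kronecker ComplexOrder

/-- The permutation matrix on the k-fold tensor power of ℂ^d associated to a
permutation π of the tensor factors. -/
noncomputable def permMat (d k : ℕ) (π : Equiv.Perm (Fin k)) :
    Matrix (Fin k → Fin d) (Fin k → Fin d) ℂ :=
  Matrix.of fun f g => if g = f ∘ π then 1 else 0

/-- The symmetrizer: the orthogonal projection onto the symmetric subspace of the
k-fold tensor power of ℂ^d. -/
noncomputable def symProj (d k : ℕ) : Matrix (Fin k → Fin d) (Fin k → Fin d) ℂ :=
  (1 / (Nat.factorial k : ℂ)) • ∑ π : Equiv.Perm (Fin k), permMat d k π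

/-- Restriction of g : Fin N → Fin d to the first M tensor factors. -/
def headM (d M N : ℕ) (hMN : M ≤ N) (g : Fin N → Fin d) : Fin M → Fin d :=
  fun i => g ⟨i, lt_of_lt_of_le i.isLt hMN⟩

/-- Restriction of g : Fin N → Fin d to the last N - M tensor factors. -/
def tailM (d M N : ℕ) (hMN : M ≤ N) (g : Fin N → Fin d) : Fin (N - M) → Fin d :=
  fun i => g ⟨M + i, by have := i.isLt; omega⟩

/-- The matrix K = |I^{⊗M}⟩⟩⟨⟨I^{⊗M}| ⊗ P₊^{(N-M)} between the M output systems,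
the first M input systems, and the remaining N-M input systems. -/
noncomputable def Kmat (d M N : ℕ) (hMN : M ≤ N) :
    Matrix ((Fin M → Fin d) × (Fin N → Fin d)) ((Fin M → Fin d) × (Fin N → Fin d)) ℂ :=
  Matrix.of fun p q =>
    if p.1 = headM d M N hMN p.2 ∧ q.1 = headM d M N hMN q.2 then
      symProj d (N - M) (tailM d M N hMN p.2) (tailM d M N hMN q.2)
    else 0

/-- The Choi matrix of the symmetric partial trace channel from N to M ≤ N copies. -/
noncomputable def Cplus (d M N : ℕ) (hMN : M ≤ N) :
    Matrix ((Fin M → Fin d) × (Fin N → Fin d)) ((Fin M → Fin d) × (Fin N → Fin d)) ℂ :=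
  (symProj d M ⊗ₖ symProj d N) * Kmat d M N hMN * (symProj d M ⊗ₖ symProj d N)

/-- The number of permutations of the index type carrying the word `f` to the word `g`. -/
noncomputable def permCount {ι α : Type*} [Fintype ι] [DecidableEq ι] [DecidableEq α]
    (f g : ι → α) : ℂ :=
  ∑ π : Equiv.Perm ι, if g = f ∘ π then 1 else 0

section permCount

variable {ι κ α : Type*} [Fintype ι] [DecidableEq ι] [Fintype κ] [DecidableEq κ] [DecidableEq α]

theorem permCount_comp_equiv (e : κ ≃ ι) (f g : ι → α) :
    permCount (f ∘ e) (g ∘ e) = permCount f g := by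
  unfold permCount
  rw [← Equiv.sum_comp e.permCongr]
  refine Finset.sum_congr rfl fun π _ => ?_
  congr 1
  rw [eq_iff_iff, ← e.surjective.injective_comp_right.eq_iff]
  have : (f ∘ ⇑(e.permCongr π)) ∘ e = (f ∘ e) ∘ π := by
    ext i; simp
  rw [this]

theorem permCount_perm_left (σ : Equiv.Perm ι) (f g : ι → α) :
    permCount (f ∘ σ) g = permCount f g := by
  unfold permCount
  exact Equiv.sum_comp (Equiv.mulLeft σ) fun π => if g = f ∘ π then (1 : ℂ) else 0

theorem permCount_comm (f g : ι → α) : permCount f g = permCount g f := by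
  unfold permCount
  rw [← Equiv.sum_comp (Equiv.inv (Equiv.Perm ι))]
  refine Finset.sum_congr rfl fun π _ => ?_
  congr 1
  rw [eq_iff_iff]
  constructor
  · rintro rfl; ext i; simp
  · rintro rfl; ext i; simp

theorem star_permCount (f g : ι → α) : star (permCount f g) = permCount f g := by
  simp [permCount]

theorem sum_permCount_option [Fintype α] (f g : ι → α) :
    ∑ x, permCount (fun o : Option ι => o.elim x f) (fun o => o.elim x g) =
      (Fintype.card α + Fintype.card ι) * permCount f g := by
  have key (x : α) (i : Option ι) (σ : Equiv.Perm ι) :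
      ((fun o : Option ι => o.elim x g) =
        (fun o : Option ι => o.elim x f) ∘ (Equiv.swap none i * Equiv.optionCongr σ)) ↔
      i.elim x f = x ∧ g = f ∘ σ := by
    rw [funext_iff, Option.forall]
    simp only [Option.elim_none, Option.elim_some, Function.comp_apply, Equiv.Perm.mul_apply,
      Equiv.optionCongr_apply, Option.map_none, Option.map_some, Equiv.swap_apply_left]
    rw [eq_comm (a := x), funext_iff]
    refine and_congr_right fun hx => forall_congr' fun a => ?_
    by_cases hi : some (σ a) = i
    · subst hi
      simp only [Equiv.swap_apply_right, Option.elim_none, Function.comp_apply]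
      simp only [Option.elim_some] at hx
      rw [hx]
    · rw [Equiv.swap_apply_of_ne_of_ne (by simp) hi]
      simp
  have step (x : α) : permCount (fun o : Option ι => o.elim x f) (fun o => o.elim x g) =
      (∑ i : Option ι, if i.elim x f = x then 1 else 0) * permCount f g := by
    unfold permCount
    rw [← Equiv.sum_comp Equiv.Perm.decomposeOption.symm, Fintype.sum_prod_type,
      Finset.sum_mul_sum]
    refine Finset.sum_congr rfl fun i _ => Finset.sum_congr rfl fun σ _ => ?_
    simp only [Equiv.Perm.decomposeOption_symm_apply, key, ite_and, mul_ite, mul_one, mul_zero]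
    split_ifs <;> rfl
  simp_rw [step]
  rw [← Finset.sum_mul, Finset.sum_comm, Fintype.sum_option]
  have hsome (i : ι) : (∑ x : α, if (some i).elim x f = x then (1 : ℂ) else 0) = 1 :=
    Fintype.sum_ite_eq (f i) fun _ => (1 : ℂ)
  rw [Finset.sum_congr rfl fun i _ => hsome i]
  simp

theorem sum_permCount_sumElim [Fintype α] (n : ℕ) (f g : ι → α) :
    ∑ t : Fin n → α, permCount (Sum.elim f t) (Sum.elim g t) =
      (Fintype.card α + Fintype.card ι).ascFactorial n * permCount f g := by
  induction n with
  | zero =>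
    rw [Fintype.sum_unique, ← permCount_comp_equiv (Equiv.sumEmpty ι (Fin 0)).symm]
    simp [Function.comp_def]
  | succ n ih =>
    let e : Option (ι ⊕ Fin n) ≃ ι ⊕ Fin (n + 1) :=
      { toFun := fun o => o.elim (Sum.inr 0) (Sum.map id Fin.succ)
        invFun := Sum.elim (fun i => some (Sum.inl i))
          (Fin.cons none fun j => some (Sum.inr j))
        left_inv := by rintro (_ | _ | _) <;> simp
        right_inv := by
          rintro (_ | j)
          · simp
          · refine Fin.cases ?_ (fun j => ?_) j <;> simp }
    have he (h : ι → α) (x : α) (t : Fin n → α) :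
        Sum.elim h (Fin.cons x t : Fin (n + 1) → α) ∘ e = fun o => o.elim x (Sum.elim h t) := by
      ext (_ | _ | _) <;> simp [e]
    rw [← Equiv.sum_comp (Fin.consEquiv fun _ => α), Fintype.sum_prod_type, Finset.sum_comm]
    change ∑ t : Fin n → α, ∑ x : α, permCount (Sum.elim f (Fin.cons x t : Fin (n + 1) → α))
      (Sum.elim g (Fin.cons x t : Fin (n + 1) → α)) = _
    simp_rw [← permCount_comp_equiv e, he, sum_permCount_option]
    rw [← Finset.mul_sum, ih, Nat.ascFactorial_succ]
    simp only [Fintype.card_sum, Fintype.card_fin]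
    push_cast
    ring

end permCount

theorem symProj_apply (d k : ℕ) (f g : Fin k → Fin d) :
    symProj d k f g = (1 / (k.factorial : ℂ)) * permCount f g := by
  simp [symProj, permCount, permMat, Matrix.sum_apply]

theorem symProj_symm {d k : ℕ} (f g : Fin k → Fin d) : symProj d k f g = symProj d k g f := by
  rw [symProj_apply, symProj_apply, permCount_comm]

theorem symProj_isHermitian (d k : ℕ) : (symProj d k)ᴴ = symProj d k := by
  ext f g
  rw [conjTranspose_apply, symProj_symm, symProj_apply, star_mul, star_permCount]
  simp [mul_comm]

theorem symProj_mul_of_perm_invariant {d k : ℕ} {m : Type*} (X : Matrix (Fin k → Fin d) m ℂ)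
    (hX : ∀ (π : Equiv.Perm (Fin k)) f j, X (f ∘ π) j = X f j) : symProj d k * X = X := by
  ext f j
  have hk : (k.factorial : ℂ) ≠ 0 := by exact_mod_cast k.factorial_ne_zero
  have (f' : Fin k → Fin d) : symProj d k f f' * X f' j =
      ∑ π : Equiv.Perm (Fin k), if f' = f ∘ π then (1 / (k.factorial : ℂ)) * X f j else 0 := by
    rw [symProj_apply, permCount, Finset.mul_sum, Finset.sum_mul]
    refine Finset.sum_congr rfl fun π _ => ?_
    split_ifs with h
    · rw [h, hX, mul_one]
    · simp
  rw [mul_apply]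
  simp_rw [this]
  rw [Finset.sum_comm]
  simp [Fintype.card_perm, hk]

theorem symProj_comp_perm {d k : ℕ} (π : Equiv.Perm (Fin k)) (f g : Fin k → Fin d) :
    symProj d k (f ∘ π) g = symProj d k f g := by
  rw [symProj_apply, symProj_apply, permCount_perm_left]

theorem symProj_mul_self (d k : ℕ) : symProj d k * symProj d k = symProj d k :=
  symProj_mul_of_perm_invariant _ symProj_comp_perm

/-- The dimension of the symmetric subspace of the `k`-fold tensor power of `ℂ^d`. -/
def symDim (d k : ℕ) : ℕ := (d + k - 1).choose k

theorem symDim_pos {d : ℕ} (hd : 1 ≤ d) (k : ℕ) : 0 < symDim d k :=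
  Nat.choose_pos (by omega)

/-- Tracing out the factors of a symmetrizer outside a subset of tensor factors. -/
theorem sum_symProj_sumElim {d : ℕ} (hd : 1 ≤ d) {a b N : ℕ} (e : Fin a ⊕ Fin b ≃ Fin N)
    (f g : Fin a → Fin d) :
    ∑ t : Fin b → Fin d, symProj d N (Sum.elim f t ∘ e.symm) (Sum.elim g t ∘ e.symm) =
      (symDim d N / symDim d a : ℂ) * symProj d a f g := by
  have hN : N = a + b := by simpa using (Fintype.card_congr e).symm
  simp_rw [symProj_apply, permCount_comp_equiv]
  rw [← Finset.mul_sum, sum_permCount_sumElim]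
  have h1 (k : ℕ) : (symDim d k : ℂ) = d.ascFactorial k / k.factorial := by
    rw [Nat.ascFactorial_eq_factorial_mul_choose', symDim, Nat.cast_mul,
      mul_div_cancel_left₀ _ (by exact_mod_cast k.factorial_ne_zero)]
  have h2 : (d.ascFactorial N : ℂ) = d.ascFactorial a * (d + a).ascFactorial b := by
    rw [hN, ← Nat.ascFactorial_mul_ascFactorial, Nat.cast_mul]
  have h3 : (d.ascFactorial a : ℂ) ≠ 0 := by
    obtain ⟨d, rfl⟩ := Nat.exists_eq_add_of_le' hd
    exact_mod_cast (Nat.ascFactorial_pos d a).ne'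
  have h4 (k : ℕ) : (k.factorial : ℂ) ≠ 0 := by exact_mod_cast k.factorial_ne_zero
  have := h4 a
  have := h4 N
  rw [h1, h1, h2]
  simp only [Fintype.card_fin]
  field_simp

theorem symProj_trace {d : ℕ} (hd : 1 ≤ d) (k : ℕ) : (symProj d k).trace = symDim d k := by
  have h := sum_symProj_sumElim hd (Equiv.emptySum (Fin 0) (Fin k)) Fin.elim0 Fin.elim0
  have h0 (t : Fin k → Fin d) :
      (Sum.elim Fin.elim0 t ∘ (Equiv.emptySum (Fin 0) (Fin k)).symm : Fin k → Fin d) = t := by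
    ext i; simp
  simp only [h0] at h
  rw [Matrix.trace]
  simp only [diag_apply]
  rw [h, symProj_apply]
  simp [symDim, permCount, eq_iff_true_of_subsingleton]

/-- Splitting off the first `M` of `N` tensor factors. -/
def splitEquiv {M N : ℕ} (hMN : M ≤ N) : Fin M ⊕ Fin (N - M) ≃ Fin N :=
  finSumFinEquiv.trans (finCongr (Nat.add_sub_cancel' hMN))

/-- The juxtaposition of two words of lengths `M` and `N - M`. -/
def glue {d M N : ℕ} (hMN : M ≤ N) (f : Fin M → Fin d) (t : Fin (N - M) → Fin d) :
    Fin N → Fin d :=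
  Sum.elim f t ∘ (splitEquiv hMN).symm

section glue

variable {d M N : ℕ} (hMN : M ≤ N)

theorem headM_glue (f : Fin M → Fin d) (t : Fin (N - M) → Fin d) :
    headM d M N hMN (glue hMN f t) = f := by
  ext i
  have : (⟨i, lt_of_lt_of_le i.isLt hMN⟩ : Fin N) = splitEquiv hMN (Sum.inl i) := rfl
  simp [headM, glue, this]

theorem tailM_glue (f : Fin M → Fin d) (t : Fin (N - M) → Fin d) :
    tailM d M N hMN (glue hMN f t) = t := by
  ext i
  have h : (⟨M + i, by have := i.isLt; omega⟩ : Fin N) = splitEquiv hMN (Sum.inr i) := rfl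
  simp [tailM, glue, h]

theorem glue_headM_tailM (g : Fin N → Fin d) :
    glue hMN (headM d M N hMN g) (tailM d M N hMN g) = g := by
  rw [glue, Equiv.comp_symm_eq]
  ext (i | i) <;> rfl

/-- Words of length `N` as pairs of words of lengths `M` and `N - M`. -/
def glueEquiv : (Fin M → Fin d) × (Fin (N - M) → Fin d) ≃ (Fin N → Fin d) where
  toFun p := glue hMN p.1 p.2
  invFun g := (headM d M N hMN g, tailM d M N hMN g)
  left_inv p := by simp [headM_glue, tailM_glue]
  right_inv g := glue_headM_tailM hMN g

theorem sum_symProj_glue_head (hd : 1 ≤ d) (t t' : Fin (N - M) → Fin d) :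
    ∑ f, symProj d N (glue hMN f t) (glue hMN f t') =
      (symDim d N / symDim d (N - M) : ℂ) * symProj d (N - M) t t' := by
  rw [← sum_symProj_sumElim hd ((Equiv.sumComm _ _).trans (splitEquiv hMN))]
  refine Finset.sum_congr rfl fun f _ => ?_
  have h (t : Fin (N - M) → Fin d) : glue hMN f t =
      Sum.elim t f ∘ ((Equiv.sumComm _ _).trans (splitEquiv hMN)).symm := by
    rw [Equiv.eq_comp_symm, glue, Equiv.coe_trans, ← Function.comp_assoc,
      Function.comp_assoc (Sum.elim f t)]
    ext (i | i) <;> simp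
  rw [h, h]

theorem sum_symProj_glue_tail (hd : 1 ≤ d) (f f' : Fin M → Fin d) :
    ∑ t, symProj d N (glue hMN f t) (glue hMN f' t) =
      (symDim d N / symDim d M : ℂ) * symProj d M f f' :=
  sum_symProj_sumElim hd (splitEquiv hMN) f f'

theorem symProj_glue_perm_head (π : Equiv.Perm (Fin M)) (f : Fin M → Fin d)
    (t : Fin (N - M) → Fin d) (g : Fin N → Fin d) :
    symProj d N (glue hMN (f ∘ π) t) g = symProj d N (glue hMN f t) g := by
  rw [← symProj_comp_perm ((splitEquiv hMN).permCongr (Equiv.sumCongr π (Equiv.refl _)))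
    (glue hMN f t)]
  congr 1
  ext i
  obtain ⟨i | i, rfl⟩ := (splitEquiv hMN).surjective i <;> simp [glue]

theorem symProj_glue_perm_tail (π : Equiv.Perm (Fin (N - M))) (f : Fin M → Fin d)
    (t : Fin (N - M) → Fin d) (g : Fin N → Fin d) :
    symProj d N (glue hMN f (t ∘ π)) g = symProj d N (glue hMN f t) g := by
  rw [← symProj_comp_perm ((splitEquiv hMN).permCongr (Equiv.sumCongr (Equiv.refl _) π))
    (glue hMN f t)]
  congr 1
  ext i
  obtain ⟨i | i, rfl⟩ := (splitEquiv hMN).surjective i <;> simp [glue]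

/-- The operator pairing the output systems with the first `M` input systems. -/
noncomputable def pairMat (d M N : ℕ) (hMN : M ≤ N) :
    Matrix ((Fin M → Fin d) × (Fin N → Fin d)) (Fin (N - M) → Fin d) ℂ :=
  Matrix.of fun p t => if p.2 = glue hMN p.1 t then 1 else 0

theorem glue_inj {f f' : Fin M → Fin d} {t t' : Fin (N - M) → Fin d} :
    glue hMN f t = glue hMN f' t' ↔ f = f' ∧ t = t' := by
  rw [← Prod.mk_inj]
  exact (glueEquiv hMN).injective.eq_iff (a := (f, t)) (b := (f', t'))

theorem Kmat_eq : Kmat d M N hMN =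
    pairMat d M N hMN * symProj d (N - M) * (pairMat d M N hMN)ᴴ := by
  ext ⟨f, g⟩ ⟨f', g'⟩
  rw [← glue_headM_tailM hMN g, ← glue_headM_tailM hMN g']
  simp only [Kmat, of_apply, headM_glue, tailM_glue, mul_apply, pairMat, conjTranspose_apply,
    glue_inj]
  split_ifs with h
  · simp [h.1.symm, h.2.symm]
  · rw [not_and_or] at h
    rcases h with h | h <;> simp [Ne.symm h]

theorem sum_pairMat (X : (Fin M → Fin d) × (Fin N → Fin d) → ℂ) (t : Fin (N - M) → Fin d) :
    ∑ p, X p * pairMat d M N hMN p t = ∑ f, X (f, glue hMN f t) := by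
  simp [Fintype.sum_prod_type, pairMat]

theorem pairMat_conj (X : Matrix ((Fin M → Fin d) × (Fin N → Fin d))
      ((Fin M → Fin d) × (Fin N → Fin d)) ℂ) (t t' : Fin (N - M) → Fin d) :
    ((pairMat d M N hMN)ᴴ * X * pairMat d M N hMN) t t' =
      ∑ f, ∑ f', X (f, glue hMN f t) (f', glue hMN f' t') := by
  rw [mul_apply, sum_pairMat, Finset.sum_comm]
  refine Finset.sum_congr rfl fun f' _ => ?_
  rw [mul_apply, ← sum_pairMat hMN fun p => X p (f', glue hMN f' t')]
  refine Finset.sum_congr rfl fun p _ => ?_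
  rw [mul_comm, conjTranspose_apply]
  by_cases h : p.2 = glue hMN p.1 t <;> simp [pairMat, h]

theorem pairMat_conj_symProj (hd : 1 ≤ d) :
    (pairMat d M N hMN)ᴴ * (symProj d M ⊗ₖ symProj d N) * pairMat d M N hMN =
      (symDim d N / symDim d (N - M) : ℂ) • symProj d (N - M) := by
  ext t t'
  rw [pairMat_conj, Matrix.smul_apply, smul_eq_mul, ← sum_symProj_glue_head hMN hd,
    Finset.sum_comm]
  refine Finset.sum_congr rfl fun f' _ => ?_
  have h := congrFun₂ (symProj_mul_of_perm_invariant
    (Matrix.of fun f (_ : Unit) => symProj d N (glue hMN f t) (glue hMN f' t'))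
    fun π f _ => symProj_glue_perm_head hMN π f t _) f' ()
  rw [mul_apply] at h
  simp only [of_apply] at h
  rw [← h]
  refine Finset.sum_congr rfl fun f _ => ?_
  rw [kronecker_apply, symProj_symm f]

theorem trace_kronecker_symProj_mul_Kmat (hd : 1 ≤ d)
    (ρ : Matrix (Fin M → Fin d) (Fin M → Fin d) ℂ) :
    ((ρ ⊗ₖ symProj d N) * Kmat d M N hMN).trace =
      (symDim d N / symDim d M : ℂ) * (ρ * symProj d M).trace := by
  have h (f f' : Fin M → Fin d) (t' : Fin (N - M) → Fin d) :
      ∑ t, symProj d (N - M) t' t * symProj d N (glue hMN f t) (glue hMN f' t') =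
        symProj d N (glue hMN f t') (glue hMN f' t') := by
    have h := congrFun₂ (symProj_mul_of_perm_invariant
      (Matrix.of fun t (_ : Unit) => symProj d N (glue hMN f t) (glue hMN f' t'))
      fun π t _ => symProj_glue_perm_tail hMN π f t _) t' ()
    rwa [mul_apply] at h
  rw [Kmat_eq, trace_mul_comm, Matrix.mul_assoc, Matrix.mul_assoc, trace_mul_comm,
    Matrix.mul_assoc, trace_mul_comm]
  calc
    _ = ∑ t', ∑ t, ∑ f, ∑ f', ρ f f' *
          (symProj d (N - M) t' t * symProj d N (glue hMN f t) (glue hMN f' t')) := by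
      rw [trace_mul_comm]
      refine Finset.sum_congr rfl fun t' _ => ?_
      rw [diag_apply, mul_apply]
      refine Finset.sum_congr rfl fun t _ => ?_
      rw [pairMat_conj]
      simp_rw [Finset.mul_sum, kronecker_apply]
      refine Finset.sum_congr rfl fun f _ => Finset.sum_congr rfl fun f' _ => ?_
      ring
    _ = ∑ f, ∑ f', ρ f f' * ((symDim d N / symDim d M : ℂ) * symProj d M f f') := by
      have hsum (t' : Fin (N - M) → Fin d) : ∑ t, ∑ f, ∑ f', ρ f f' *
          (symProj d (N - M) t' t * symProj d N (glue hMN f t) (glue hMN f' t')) =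
          ∑ f, ∑ f', ρ f f' * symProj d N (glue hMN f t') (glue hMN f' t') := by
        rw [Finset.sum_comm]
        refine Finset.sum_congr rfl fun f _ => ?_
        rw [Finset.sum_comm]
        refine Finset.sum_congr rfl fun f' _ => ?_
        rw [← Finset.mul_sum, h]
      simp_rw [hsum]
      rw [Finset.sum_comm]
      refine Finset.sum_congr rfl fun f _ => ?_
      rw [Finset.sum_comm]
      refine Finset.sum_congr rfl fun f' _ => ?_
      rw [← Finset.mul_sum, sum_symProj_glue_tail hMN hd]
    _ = _ := by
      simp_rw [Matrix.trace, diag_apply, mul_apply, Finset.mul_sum]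
      refine Finset.sum_congr rfl fun f _ => Finset.sum_congr rfl fun f' _ => ?_
      rw [symProj_symm f f']
      ring

end glue

section Cplus

variable {d M N : ℕ} (hMN : M ≤ N)

theorem kronecker_symProj_isHermitian :
    (symProj d M ⊗ₖ symProj d N)ᴴ = symProj d M ⊗ₖ symProj d N := by
  rw [conjTranspose_kronecker, symProj_isHermitian, symProj_isHermitian]

theorem kronecker_symProj_mul_self :
    (symProj d M ⊗ₖ symProj d N) * (symProj d M ⊗ₖ symProj d N) =
      symProj d M ⊗ₖ symProj d N := by
  rw [← mul_kronecker_mul, symProj_mul_self, symProj_mul_self]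

/-- The stacked Kraus operators of the symmetric partial trace channel. -/
noncomputable def krausMat (d M N : ℕ) (hMN : M ≤ N) :
    Matrix ((Fin M → Fin d) × (Fin N → Fin d)) (Fin (N - M) → Fin d) ℂ :=
  (symProj d M ⊗ₖ symProj d N) * pairMat d M N hMN * symProj d (N - M)

theorem krausMat_conjTranspose : (krausMat d M N hMN)ᴴ =
    symProj d (N - M) * ((pairMat d M N hMN)ᴴ * (symProj d M ⊗ₖ symProj d N)) := by
  rw [krausMat, conjTranspose_mul, conjTranspose_mul, symProj_isHermitian,
    kronecker_symProj_isHermitian]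

theorem Cplus_eq : Cplus d M N hMN = krausMat d M N hMN * (krausMat d M N hMN)ᴴ := by
  rw [krausMat_conjTranspose, krausMat, Cplus, Kmat_eq]
  simp only [Matrix.mul_assoc]
  rw [← Matrix.mul_assoc (symProj d (N - M)) (symProj d (N - M)), symProj_mul_self]

theorem krausMat_conjTranspose_mul_self (hd : 1 ≤ d) :
    (krausMat d M N hMN)ᴴ * krausMat d M N hMN =
      (symDim d N / symDim d (N - M) : ℂ) • symProj d (N - M) := by
  calc
    _ = symProj d (N - M) * ((pairMat d M N hMN)ᴴ * ((symProj d M ⊗ₖ symProj d N) *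
          (symProj d M ⊗ₖ symProj d N)) * pairMat d M N hMN) * symProj d (N - M) := by
      rw [krausMat_conjTranspose, krausMat]
      simp only [Matrix.mul_assoc]
    _ = _ := by
      rw [kronecker_symProj_mul_self, pairMat_conj_symProj hMN hd]
      simp [symProj_mul_self]

theorem krausMat_mul_symProj :
    krausMat d M N hMN * symProj d (N - M) = krausMat d M N hMN := by
  rw [krausMat, Matrix.mul_assoc, symProj_mul_self]

theorem Cplus_conjTranspose : (Cplus d M N hMN)ᴴ = Cplus d M N hMN := by
  rw [Cplus_eq, conjTranspose_mul, conjTranspose_conjTranspose]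

theorem Cplus_posSemidef : (Cplus d M N hMN).PosSemidef := by
  rw [Cplus_eq]
  exact posSemidef_self_mul_conjTranspose _

theorem Cplus_mul_self (hd : 1 ≤ d) : Cplus d M N hMN * Cplus d M N hMN =
    (symDim d N / symDim d (N - M) : ℂ) • Cplus d M N hMN := by
  rw [Cplus_eq, Matrix.mul_assoc, ← Matrix.mul_assoc (krausMat d M N hMN)ᴴ,
    krausMat_conjTranspose_mul_self hMN hd, Matrix.smul_mul, Matrix.mul_smul, ← Matrix.mul_assoc,
    krausMat_mul_symProj]

theorem kronecker_symProj_mul_Cplus :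
    (symProj d M ⊗ₖ symProj d N) * Cplus d M N hMN = Cplus d M N hMN := by
  rw [Cplus, ← Matrix.mul_assoc, ← Matrix.mul_assoc, kronecker_symProj_mul_self]

theorem Cplus_mul_kronecker_symProj :
    Cplus d M N hMN * (symProj d M ⊗ₖ symProj d N) = Cplus d M N hMN := by
  rw [Cplus, Matrix.mul_assoc, kronecker_symProj_mul_self]

theorem posSemidef_kronecker_symProj_sub_Cplus (hd : 1 ≤ d) :
    (symProj d M ⊗ₖ symProj d N -
      (symDim d (N - M) / symDim d N : ℂ) • Cplus d M N hMN).PosSemidef := by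
  have h1 : (symDim d N : ℂ) ≠ 0 := by exact_mod_cast (symDim_pos hd N).ne'
  have h2 : (symDim d (N - M) : ℂ) ≠ 0 := by exact_mod_cast (symDim_pos hd (N - M)).ne'
  set X := symProj d M ⊗ₖ symProj d N -
      (symDim d (N - M) / symDim d N : ℂ) • Cplus d M N hMN with hX
  have hH : Xᴴ = X := by
    rw [hX, conjTranspose_sub, conjTranspose_smul, kronecker_symProj_isHermitian,
      Cplus_conjTranspose]
    simp
  have hsq : Xᴴ * X = X := by
    rw [hH, hX, sub_mul, mul_sub, mul_sub, kronecker_symProj_mul_self, Matrix.smul_mul,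
      Matrix.smul_mul, Matrix.mul_smul, Matrix.mul_smul, kronecker_symProj_mul_Cplus, Cplus_mul_kronecker_symProj,
      Cplus_mul_self hMN hd, smul_smul (_ / _ : ℂ) (_ / _ : ℂ) (Cplus d M N hMN),
      div_mul_div_cancel₀ h1, div_self h2, one_smul, sub_self, sub_zero]
  rw [← hsq]
  exact posSemidef_conjTranspose_mul_self X

theorem le_of_posSemidef_sub_Cplus (hd : 1 ≤ d) (p : ℝ)
    (ρ : Matrix (Fin M → Fin d) (Fin M → Fin d) ℂ) (htr : ρ.trace = 1)
    (hρ : symProj d M * ρ * symProj d M = ρ)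
    (h : (ρ ⊗ₖ symProj d N - (p : ℂ) • Cplus d M N hMN).PosSemidef) :
    p ≤ (symDim d (N - M) : ℝ) / ((symDim d N : ℝ) * (symDim d M : ℝ)) := by
  have h1 : (0 : ℝ) < symDim d N := by exact_mod_cast symDim_pos hd N
  have h2 : (0 : ℝ) < symDim d (N - M) := by exact_mod_cast symDim_pos hd (N - M)
  have h3 : (0 : ℝ) < symDim d M := by exact_mod_cast symDim_pos hd M
  have h1' : (symDim d N : ℂ) ≠ 0 := by exact_mod_cast h1.ne'
  have h2' : (symDim d (N - M) : ℂ) ≠ 0 := by exact_mod_cast h2.ne'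
  have key : ((krausMat d M N hMN)ᴴ * (ρ ⊗ₖ symProj d N - (p : ℂ) • Cplus d M N hMN) *
      krausMat d M N hMN).trace =
      ((symDim d N / symDim d M - p * (symDim d N * symDim d N / symDim d (N - M)) : ℝ) : ℂ) := by
    have hfirst : (ρ ⊗ₖ symProj d N * Cplus d M N hMN).trace =
        (symDim d N / symDim d M : ℂ) := by
      have hρ' : ρ * symProj d M = ρ := by
        rw [← hρ, Matrix.mul_assoc, symProj_mul_self]
      rw [Cplus, ← Matrix.mul_assoc, trace_mul_comm, ← Matrix.mul_assoc, ← Matrix.mul_assoc,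
        ← mul_kronecker_mul, ← mul_kronecker_mul, hρ, symProj_mul_self,
        symProj_mul_self, trace_kronecker_symProj_mul_Kmat hMN hd, hρ', htr, mul_one]
    have hC : (Cplus d M N hMN).trace = symDim d N := by
      rw [Cplus_eq, trace_mul_comm, krausMat_conjTranspose_mul_self hMN hd, trace_smul,
        symProj_trace hd, smul_eq_mul, div_mul_cancel₀ _ h2']
    rw [Matrix.mul_assoc, trace_mul_comm, Matrix.mul_assoc, ← Cplus_eq, sub_mul, trace_sub,
      hfirst, Matrix.smul_mul, trace_smul, Cplus_mul_self hMN hd, trace_smul, hC]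
    push_cast
    simp only [smul_eq_mul]
    ring
  have hpos := (h.conjTranspose_mul_mul_same (krausMat d M N hMN)).trace_nonneg
  rw [key, Complex.zero_le_real, sub_nonneg, mul_div_assoc', div_le_div_iff₀ h2 h3] at hpos
  rw [le_div_iff₀ (mul_pos h1 h3)]
  nlinarith

end Cplus

/-- The maximum probability of teleporting M copies of an unknown pure state to the past
given N ≥ M copies in the future is d₊^{(N-M)}/(d₊^{(N)} d₊^{(M)}). -/
theorem trace_channel_sim_prob (d M N : ℕ) (hd : 1 ≤ d) (hM : 1 ≤ M) (hMN : M ≤ N)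
    (p : ℝ) (hp : 0 ≤ p) :
    (∃ ρ₀ : Matrix (Fin M → Fin d) (Fin M → Fin d) ℂ,
        ρ₀.PosSemidef ∧ ρ₀.trace = 1 ∧ symProj d M * ρ₀ * symProj d M = ρ₀ ∧
          (ρ₀ ⊗ₖ symProj d N - (p : ℂ) • Cplus d M N hMN).PosSemidef)
      ↔ p ≤ (Nat.choose (d + (N - M) - 1) (N - M) : ℝ) /
          ((Nat.choose (d + N - 1) N : ℝ) * (Nat.choose (d + M - 1) M : ℝ)) := by
  change _ ↔ p ≤ (symDim d (N - M) : ℝ) / ((symDim d N : ℝ) * (symDim d M : ℝ))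
  constructor
  · rintro ⟨ρ, -, htr, hρ, h⟩
    exact le_of_posSemidef_sub_Cplus hMN hd p ρ htr hρ h
  · intro hle
    have hdN : (0 : ℝ) < symDim d N := by exact_mod_cast symDim_pos hd N
    have hdM : (0 : ℝ) < symDim d M := by exact_mod_cast symDim_pos hd M
    have hdM' : (symDim d M : ℂ) ≠ 0 := by exact_mod_cast hdM.ne'
    have hinv : (0 : ℂ) ≤ (symDim d M : ℂ)⁻¹ := by simp
    have hP : (symProj d M).PosSemidef := by
      have := posSemidef_conjTranspose_mul_self (symProj d M)
      rwa [symProj_isHermitian, symProj_mul_self] at this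
    refine ⟨(symDim d M : ℂ)⁻¹ • symProj d M, hP.smul hinv, ?_, ?_, ?_⟩
    · rw [trace_smul, symProj_trace hd, smul_eq_mul, inv_mul_cancel₀ hdM']
    · rw [Matrix.mul_smul, Matrix.smul_mul, symProj_mul_self, symProj_mul_self]
    · have hcoef : (0 : ℂ) ≤ (symDim d M : ℂ)⁻¹ * (symDim d (N - M) / symDim d N) - p := by
        have : (0 : ℂ) ≤ ((symDim d (N - M) / (symDim d N * symDim d M) - p : ℝ) : ℂ) := by
          rw [Complex.zero_le_real]
          exact sub_nonneg.mpr hle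
        convert this using 1
        push_cast
        rw [mul_comm, ← div_eq_mul_inv, div_div]
      have hsplit : ((symDim d M : ℂ)⁻¹ • symProj d M) ⊗ₖ symProj d N -
          (p : ℂ) • Cplus d M N hMN =
          (symDim d M : ℂ)⁻¹ • (symProj d M ⊗ₖ symProj d N -
            (symDim d (N - M) / symDim d N : ℂ) • Cplus d M N hMN) +
          ((symDim d M : ℂ)⁻¹ * (symDim d (N - M) / symDim d N) - p) • Cplus d M N hMN := by
        rw [smul_kronecker]
        module
      rw [hsplit]
      exact ((posSemidef_kronecker_symProj_sub_Cplus hMN hd).smul hinv).add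
        ((Cplus_posSemidef hMN).smul hcoef)
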